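/- For a *-action of U_ℂ(𝔤) on a unital *-algebra A and a ∈ U(U_ℂ(𝔤), A), the restriction α = a|_𝔤 satisfies: (i) α takes values in anti-Hermitian central elements of A, (ii) α is a Chevalley–Eilenberg 1-cocycle, i.e., α([ξ,η]) = ξ ▷ α(η) − η ▷ α(ξ) for all ξ, η ∈ 𝔤, and (iii) the map a ↦ a|_𝔤 is an injective group homomorphism from U(U_ℂ(𝔤), A) to Z¹_CE(𝔤, Z(A)_{anti-Hermitian}). -/

import Mathlib

open TensorProduct

noncomputable section

/-- The data of a Hopf `*`-algebra structure (over `ℂ`) on a `*`-algebra `H`,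
together with a chosen Sweedler representation `rep` of the comultiplication:
`Δ(g) = Σᵢ g₍₁₎ᵢ ⊗ g₍₂₎ᵢ` where the pairs `(g₍₁₎ᵢ, g₍₂₎ᵢ)` are listed by `rep g`. -/
structure HopfStarData (H : Type) [Ring H] [Algebra ℂ H] [StarRing H] : Type where
  comul : H →ₗ[ℂ] H ⊗[ℂ] H
  counit : H →ₗ[ℂ] ℂ
  antipode : H →ₗ[ℂ] H
  rep : H → List (H × H)
  rep_spec : ∀ g, comul g = ((rep g).map fun p => p.1 ⊗ₜ[ℂ] p.2).sum
  comul_one : comul 1 = 1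
  comul_mul : ∀ g h, comul (g * h) = comul g * comul h
  counit_one : counit 1 = 1
  counit_mul : ∀ g h, counit (g * h) = counit g * counit h
  coassoc : (TensorProduct.assoc ℂ H H H).toLinearMap ∘ₗ
      (TensorProduct.map comul LinearMap.id) ∘ₗ comul
      = (TensorProduct.map LinearMap.id comul) ∘ₗ comul
  counit_comul_left : ∀ g, ((rep g).map fun p => counit p.1 • p.2).sum = g
  counit_comul_right : ∀ g, ((rep g).map fun p => counit p.2 • p.1).sum = g
  antipode_left : ∀ g, ((rep g).map fun p => antipode p.1 * p.2).sum = counit g • (1 : H)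
  antipode_right : ∀ g, ((rep g).map fun p => p.1 * antipode p.2).sum = counit g • (1 : H)
  comul_star : ∀ g, comul (star g) = ((rep g).map fun p => star p.1 ⊗ₜ[ℂ] star p.2).sum
  counit_star : ∀ g, counit (star g) = starRingEnd ℂ (counit g)
  antipode_star : ∀ g, antipode (star (antipode (star g))) = g

variable {H A : Type} [Ring H] [Algebra ℂ H] [StarRing H]

/-- `act` is a Hopf-algebraic `*`-action of `(H, D)` on the `*`-algebra `A`:
`g ▷ (xy) = (g₍₁₎ ▷ x)(g₍₂₎ ▷ y)`, `g ▷ 1 = ε(g)1` and `(g ▷ x)* = S(g)* ▷ x*`. -/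
def IsStarAction [Ring A] [Algebra ℂ A] [StarRing A]
    (D : HopfStarData H) (act : H →ₗ[ℂ] A →ₗ[ℂ] A) : Prop :=
  (∀ g h x, act (g * h) x = act g (act h x)) ∧
  (∀ x, act 1 x = x) ∧
  (∀ g x y, act g (x * y) = ((D.rep g).map fun p => act p.1 x * act p.2 y).sum) ∧
  (∀ g, act g 1 = D.counit g • 1) ∧
  (∀ g x, star (act g x) = act (star (D.antipode g)) (star x))

/-- The convolution product on `Hom(H, A)`: `(a * b)(g) = a(g₍₁₎) b(g₍₂₎)`. -/
def conv [Ring A] [Algebra ℂ A] (D : HopfStarData H) (a b : H →ₗ[ℂ] A) : H →ₗ[ℂ] A :=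
  LinearMap.mul' ℂ A ∘ₗ TensorProduct.map a b ∘ₗ D.comul

/-- The convolution unit `e(g) = ε(g) 1`. -/
def convUnit [Ring A] [Algebra ℂ A] (D : HopfStarData H) : H →ₗ[ℂ] A :=
  Algebra.linearMap ℂ A ∘ₗ D.counit

/-- Membership in `U(H, A)`: normalization, the cocycle condition, centrality and
unitarity, cf. (13)–(16) in the paper. -/
def IsUElem [Ring A] [Algebra ℂ A] [StarRing A]
    (D : HopfStarData H) (act : H →ₗ[ℂ] A →ₗ[ℂ] A) (a : H →ₗ[ℂ] A) : Prop :=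
  a 1 = 1 ∧
  (∀ g h, a (g * h) = ((D.rep g).map fun p => a p.1 * act p.2 (a h)).sum) ∧
  (∀ g b, ((D.rep g).map fun p => act p.1 b * a p.2).sum
        = ((D.rep g).map fun p => a p.1 * act p.2 b).sum) ∧
  (∀ g, ((D.rep g).map fun p => a p.1 * star (a (D.antipode (star p.2)))).sum
      = D.counit g • 1)

/-- `c` is a central element of `A`. -/
def IsCentral [Ring A] (c : A) : Prop := ∀ x, c * x = x * c

/-- `c` is a unitary central element of `A`. -/
def IsUnitaryCentral [Ring A] [StarRing A] (c : A) : Prop :=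
  IsCentral c ∧ star c * c = 1 ∧ c * star c = 1

/-- For a unitary central element `c`, the map `ĉ(g) = c · (g ▷ c⁻¹) = c · (g ▷ c*)`. -/
def chat [Ring A] [Algebra ℂ A] [StarRing A]
    (act : H →ₗ[ℂ] A →ₗ[ℂ] A) (c : A) : H →ₗ[ℂ] A :=
  LinearMap.mulLeft ℂ c ∘ₗ act.flip (star c)

variable {𝔤 : Type} [LieRing 𝔤] [LieAlgebra ℝ 𝔤]

namespace HopfStarData

section Tensor

variable {B : Type*} [Ring B] [Algebra ℂ B]

/-- The span of the tensors `w ⊗ h` with `w ∈ W`. -/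
def leftTensors (W : Submodule ℂ B) : Submodule ℂ (B ⊗[ℂ] B) :=
  Submodule.map₂ (TensorProduct.mk ℂ B B) W ⊤

lemma tmul_mem_leftTensors {W : Submodule ℂ B} {w : B} (hw : w ∈ W) (h : B) :
    w ⊗ₜ[ℂ] h ∈ leftTensors W :=
  Submodule.apply_mem_map₂ (TensorProduct.mk ℂ B B) hw Submodule.mem_top

lemma leftTensors_mono {U W : Submodule ℂ B} (h : U ≤ W) : leftTensors U ≤ leftTensors W :=
  Submodule.map₂_le_map₂_left h

lemma mul_mem_leftTensors {U V W : Submodule ℂ B} (h : ∀ u ∈ U, ∀ v ∈ V, u * v ∈ W)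
    {s t : B ⊗[ℂ] B} (hs : s ∈ leftTensors U) (ht : t ∈ leftTensors V) :
    s * t ∈ leftTensors W := by
  have key : ∀ u ∈ U, ∀ x : B, leftTensors V ≤
      (leftTensors W).comap (LinearMap.mulLeft ℂ (u ⊗ₜ[ℂ] x)) := fun u hu x =>
    Submodule.map₂_le.2 fun v hv y _ => by
      simpa using tmul_mem_leftTensors (h u hu v hv) (x * y)
  have : leftTensors U ≤ (leftTensors W).comap (LinearMap.mulRight ℂ t) :=
    Submodule.map₂_le.2 fun u hu x _ => key u hu x ht
  exact this hs

/-- Contraction of the second tensor factor against a functional. -/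
def contract (f : B →ₗ[ℂ] ℂ) : B ⊗[ℂ] B →ₗ[ℂ] B :=
  (TensorProduct.rid ℂ B).toLinearMap ∘ₗ f.lTensor B

@[simp]
lemma contract_tmul (f : B →ₗ[ℂ] ℂ) (x y : B) : contract f (x ⊗ₜ[ℂ] y) = f y • x := by
  simp [contract]

lemma contract_mem {W : Submodule ℂ B} (f : B →ₗ[ℂ] ℂ) {t : B ⊗[ℂ] B}
    (ht : t ∈ leftTensors W) : contract f t ∈ W := by
  have : leftTensors W ≤ W.comap (contract f) := Submodule.map₂_le.2 fun w hw x _ => by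
    simpa using W.smul_mem (f x) hw
  exact this ht

lemma contract_mul_tmul_one (f : B →ₗ[ℂ] ℂ) (t : B ⊗[ℂ] B) (h : B) :
    contract f (t * h ⊗ₜ[ℂ] 1) = contract f t * h := by
  induction t with
  | zero => simp
  | tmul x y => simp
  | add s t hs ht => simp [add_mul, hs, ht]

lemma contract_tmul_one_mul (f : B →ₗ[ℂ] ℂ) (t : B ⊗[ℂ] B) (h : B) :
    contract f (h ⊗ₜ[ℂ] 1 * t) = h * contract f t := by
  induction t with
  | zero => simp
  | tmul x y => simp
  | add s t hs ht => simp [mul_add, hs, ht]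

lemma mem_leftTensors_of_contract_mem {W : Submodule ℂ B} {t : B ⊗[ℂ] B}
    (h : ∀ f : B →ₗ[ℂ] ℂ, contract f t ∈ W) : t ∈ leftTensors W := by
  classical
  let b := Module.Basis.ofVectorSpace ℂ B
  obtain ⟨c, rfl⟩ := TensorProduct.eq_repr_basis_right b t
  refine Submodule.sum_mem _ fun i _ => tmul_mem_leftTensors ?_ _
  have hi := h (b.coord i)
  rw [Finsupp.sum, map_sum] at hi
  simpa [Finsupp.single_apply, ite_smul,
    ite_eq_right_iff.2 (Eq.symm : c i = 0 → 0 = c i)] using hi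

end Tensor

variable (D : HopfStarData H)

lemma sum_rep {M : Type} [AddCommGroup M] [Module ℂ M] (φ : H ⊗[ℂ] H →ₗ[ℂ] M) (g : H) :
    ((D.rep g).map fun p => φ (p.1 ⊗ₜ[ℂ] p.2)).sum = φ (D.comul g) := by
  rw [D.rep_spec, map_list_sum, List.map_map]
  rfl

lemma contract_counit_comul (g : H) : contract D.counit (D.comul g) = g := by
  rw [← sum_rep]
  simpa using D.counit_comul_right g

lemma nontrivial (D : HopfStarData H) : Nontrivial H :=
  ⟨1, 0, fun h => by simpa [D.counit_one] using congrArg D.counit h⟩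

lemma antipode_one : D.antipode 1 = 1 := by
  have h := D.antipode_left 1
  have h' := D.sum_rep (LinearMap.mul' ℂ H ∘ₗ TensorProduct.map D.antipode LinearMap.id) 1
  simp only [LinearMap.comp_apply, TensorProduct.map_tmul, LinearMap.mul'_apply,
    LinearMap.id_apply] at h'
  rw [h', D.comul_one, Algebra.TensorProduct.one_def] at h
  simpa [D.counit_one] using h

/-- The map `g ↦ Δ(g) - g ⊗ 1`. -/
def comulSub : H →ₗ[ℂ] H ⊗[ℂ] H := D.comul - (TensorProduct.mk ℂ H H).flip 1

lemma comul_eq (g : H) : D.comul g = g ⊗ₜ[ℂ] 1 + D.comulSub g := by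
  simp [comulSub]

lemma comulSub_mul (g h : H) : D.comulSub (g * h) =
    D.comulSub g * h ⊗ₜ[ℂ] 1 + g ⊗ₜ[ℂ] 1 * D.comulSub h + D.comulSub g * D.comulSub h := by
  have h' := D.comul_mul g h
  rw [comul_eq, comul_eq, comul_eq] at h'
  have e : (g * h) ⊗ₜ[ℂ] (1 : H) = g ⊗ₜ[ℂ] 1 * h ⊗ₜ[ℂ] 1 := by simp
  rw [e] at h'
  rw [← sub_eq_zero] at h' ⊢
  rw [← h']
  noncomm_ring

/-- The coradical filtration, shifted by one. -/
def coradAux : ℕ → Submodule ℂ H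
  | 0 => ⊥
  | n + 1 => (leftTensors (coradAux n)).comap D.comulSub

/-- The coradical filtration, extended by zero to negative degrees. -/
def corad (n : ℤ) : Submodule ℂ H := D.coradAux (n + 1).toNat

lemma corad_neg {n : ℤ} (hn : n < 0) : D.corad n = ⊥ := by
  rw [corad, Int.toNat_of_nonpos (by omega)]
  rfl

lemma mem_corad_iff {n : ℤ} (hn : 0 ≤ n) {g : H} :
    g ∈ D.corad n ↔ D.comulSub g ∈ leftTensors (D.corad (n - 1)) := by
  obtain ⟨k, rfl⟩ := Int.eq_ofNat_of_zero_le hn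
  have h1 : ((k : ℤ) + 1).toNat = k + 1 := by omega
  have h2 : ((k : ℤ) - 1 + 1).toNat = k := by omega
  rw [corad, corad, h1, h2]
  rfl

lemma comulSub_mem {n : ℤ} {g : H} (hg : g ∈ D.corad n) :
    D.comulSub g ∈ leftTensors (D.corad (n - 1)) := by
  rcases lt_or_ge n 0 with hn | hn
  · rw [D.corad_neg hn, Submodule.mem_bot] at hg
    simp [hg]
  · exact (D.mem_corad_iff hn).1 hg

lemma corad_le_succ (n : ℕ) : D.corad ((n : ℤ) - 1) ≤ D.corad n := by
  induction n with
  | zero => simp [D.corad_neg]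
  | succ n ih =>
    intro g hg
    rw [D.mem_corad_iff (by omega)]
    have := D.comulSub_mem hg
    push_cast at this ⊢
    rw [add_sub_cancel_right] at this ⊢
    exact leftTensors_mono ih this

lemma corad_mono : Monotone D.corad := by
  refine monotone_int_of_le_succ fun n => ?_
  rcases lt_or_ge n 0 with hn | hn
  · simp [D.corad_neg hn]
  · obtain ⟨k, rfl⟩ := Int.eq_ofNat_of_zero_le hn
    simpa using D.corad_le_succ (k + 1)

lemma mul_mem_corad {n m : ℤ} {g h : H} (hg : g ∈ D.corad n) (hh : h ∈ D.corad m) :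
    g * h ∈ D.corad (n + m) := by
  obtain ⟨k, hk⟩ : ∃ k : ℕ, n + m ≤ k := ⟨(n + m).toNat, Int.self_le_toNat _⟩
  induction k using Nat.strong_induction_on generalizing n m g h with
  | _ k ih =>
    rcases lt_or_ge n 0 with hn | hn
    · rw [D.corad_neg hn, Submodule.mem_bot] at hg
      simp [hg]
    rcases lt_or_ge m 0 with hm | hm
    · rw [D.corad_neg hm, Submodule.mem_bot] at hh
      simp [hh]
    have step : ∀ {i j : ℤ}, i + j < n + m → ∀ u ∈ D.corad i, ∀ v ∈ D.corad j,
        u * v ∈ D.corad (i + j) := by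
      intro i j hij u hu v hv
      rcases lt_or_ge i 0 with hi | hi
      · rw [D.corad_neg hi, Submodule.mem_bot] at hu
        simp [hu]
      rcases lt_or_ge j 0 with hj | hj
      · rw [D.corad_neg hj, Submodule.mem_bot] at hv
        simp [hv]
      exact ih (i + j).toNat (by omega) hu hv (Int.self_le_toNat _)
    rw [D.mem_corad_iff (by omega), comulSub_mul]
    have hg' := D.comulSub_mem hg
    have hh' := D.comulSub_mem hh
    refine add_mem (add_mem ?_ ?_) ?_
    · refine mul_mem_leftTensors (fun u hu v hv => ?_) hg' (tmul_mem_leftTensors hh 1)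
      exact D.corad_mono (by omega) (step (by omega) u hu v hv)
    · refine mul_mem_leftTensors (fun u hu v hv => ?_) (tmul_mem_leftTensors hg 1) hh'
      exact D.corad_mono (by omega) (step (by omega) u hu v hv)
    · refine mul_mem_leftTensors (fun u hu v hv => ?_) hg' hh'
      exact D.corad_mono (by omega) (step (by omega) u hu v hv)

lemma mem_corad_zero_iff {g : H} : g ∈ D.corad 0 ↔ ∃ c : ℂ, g = c • (1 : H) := by
  rw [D.mem_corad_iff le_rfl, D.corad_neg (by norm_num), leftTensors, Submodule.map₂_bot_left,
    Submodule.mem_bot]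
  constructor
  · intro h
    refine ⟨D.counit g, ?_⟩
    have h' := D.counit_comul_left g
    have h'' := D.sum_rep ((TensorProduct.lid ℂ H).toLinearMap ∘ₗ D.counit.rTensor H) g
    simp only [LinearMap.comp_apply, LinearMap.rTensor_tmul, LinearEquiv.coe_coe,
      TensorProduct.lid_tmul] at h''
    rw [h'', comul_eq, h] at h'
    simpa using h'.symm
  · rintro ⟨c, rfl⟩
    simp [comulSub, D.comul_one, Algebra.TensorProduct.one_def]

/-- The action `g ↦ Σ f(g₍₂₎) g₍₁₎` of a functional `f`. -/
def hit (f : H →ₗ[ℂ] ℂ) : Module.End ℂ H := contract f ∘ₗ D.comul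

lemma hit_eq {f : H →ₗ[ℂ] ℂ} (hf : f 1 = 0) (g : H) :
    D.hit f g = contract f (D.comulSub g) := by
  simp [hit, comul_eq, hf]

lemma hit_mem {f : H →ₗ[ℂ] ℂ} (hf : f 1 = 0) {n : ℤ} {g : H} (hg : g ∈ D.corad n) :
    D.hit f g ∈ D.corad (n - 1) := by
  rw [D.hit_eq hf]
  exact contract_mem f (D.comulSub_mem hg)

lemma hit_pow_mem {f : H →ₗ[ℂ] ℂ} (hf : f 1 = 0) (k : ℕ) {n : ℤ} {g : H}
    (hg : g ∈ D.corad n) : (D.hit f ^ k) g ∈ D.corad (n - k) := by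
  induction k generalizing n g with
  | zero => simpa using hg
  | succ k ih =>
    rw [pow_succ, Module.End.mul_apply]
    exact D.corad_mono (by push_cast; omega) (ih (D.hit_mem hf hg))

lemma hit_mul_sub_mem {f : H →ₗ[ℂ] ℂ} (hf : f 1 = 0) {n m : ℤ} {g h : H}
    (hg : g ∈ D.corad n) (hh : h ∈ D.corad m) :
    D.hit f (g * h) - (D.hit f g * h + g * D.hit f h) ∈ D.corad (n + m - 2) := by
  rw [D.hit_eq hf, D.hit_eq hf, D.hit_eq hf, comulSub_mul, map_add, map_add,
    contract_mul_tmul_one, contract_tmul_one_mul, add_sub_cancel_left]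
  refine contract_mem f (mul_mem_leftTensors (fun u hu v hv => ?_) (D.comulSub_mem hg)
    (D.comulSub_mem hh))
  exact D.corad_mono (by omega) (D.mul_mem_corad hu hv)

/-- The leading term of a power of `hit f` on a product. -/
lemma hit_pow_mul_sub_mem {f : H →ₗ[ℂ] ℂ} (hf : f 1 = 0) (k : ℕ) {a b : ℕ} (hk : a + b = k)
    {n m : ℤ} {g h : H} (hg : g ∈ D.corad n) (hh : h ∈ D.corad m)
    (hg' : (D.hit f ^ (a + 1)) g ∈ D.corad (n - a - 2))
    (hh' : (D.hit f ^ (b + 1)) h ∈ D.corad (m - b - 2)) :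
    (D.hit f ^ k) (g * h) - (k.choose a) • ((D.hit f ^ a) g * (D.hit f ^ b) h)
      ∈ D.corad (n + m - k - 1) := by
  induction k generalizing a b n m g h with
  | zero =>
    obtain ⟨rfl, rfl⟩ : a = 0 ∧ b = 0 := by omega
    simp
  | succ k ih =>
    have hr := D.hit_pow_mem hf k (D.hit_mul_sub_mem hf hg hh)
    have hr' : (D.hit f ^ (k + 1)) (g * h) - ((D.hit f ^ k) (D.hit f g * h) +
        (D.hit f ^ k) (g * D.hit f h)) ∈ D.corad (n + m - (k + 1 : ℕ) - 1) := by
      rw [pow_succ, Module.End.mul_apply, ← map_add, ← map_sub]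
      exact D.corad_mono (by push_cast; omega) hr
    match a, b, hk with
    | 0, 0, hk => omega
    | 0, b + 1, hk =>
      obtain rfl : b = k := by omega
      have h1 := D.hit_pow_mem hf b (D.mul_mem_corad (by simpa using hg') hh)
      have h2 := ih (zero_add b) hg (D.hit_mem hf hh) hg' (by
        rw [← Module.End.mul_apply, ← pow_succ]
        exact D.corad_mono (by push_cast; omega) hh')
      have := add_mem (add_mem hr' (D.corad_mono (by push_cast; omega) h1))
        (D.corad_mono (by push_cast; omega) h2)
      convert this using 1
      simp only [Nat.choose_zero_right, one_smul, pow_zero, Module.End.one_apply]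
      rw [← Module.End.mul_apply (D.hit f ^ b) (D.hit f) h, ← pow_succ]
      abel
    | a + 1, 0, hk =>
      obtain rfl : a = k := by omega
      have h1 := D.hit_pow_mem hf a (D.mul_mem_corad hg (by simpa using hh'))
      have h2 := ih (add_zero a) (D.hit_mem hf hg) hh (by
        rw [← Module.End.mul_apply, ← pow_succ]
        exact D.corad_mono (by push_cast; omega) hg') hh'
      have := add_mem (add_mem hr' (D.corad_mono (by push_cast; omega) h1))
        (D.corad_mono (by push_cast; omega) h2)
      convert this using 1
      simp only [Nat.choose_self, one_smul, pow_zero, Module.End.one_apply]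
      rw [← Module.End.mul_apply (D.hit f ^ a) (D.hit f) g, ← pow_succ]
      abel
    | a + 1, b + 1, hk =>
      have h1 := ih (a := a) (b := b + 1) (by omega) (D.hit_mem hf hg) hh (by
        rw [← Module.End.mul_apply, ← pow_succ]
        exact D.corad_mono (by push_cast; omega) hg') hh'
      have h2 := ih (a := a + 1) (b := b) (by omega) hg (D.hit_mem hf hh) hg' (by
        rw [← Module.End.mul_apply, ← pow_succ]
        exact D.corad_mono (by push_cast; omega) hh')
      rw [← Module.End.mul_apply (D.hit f ^ a), ← pow_succ] at h1
      rw [← Module.End.mul_apply (D.hit f ^ b), ← pow_succ] at h2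
      have := add_mem (add_mem hr' (D.corad_mono (by push_cast; omega) h1))
        (D.corad_mono (by push_cast; omega) h2)
      convert this using 1
      rw [Nat.choose_succ_succ, add_smul]
      abel

lemma exists_hit_not_mem {n : ℤ} (hn : 0 ≤ n) {g : H} (hg : g ∉ D.corad n) :
    ∃ f : H →ₗ[ℂ] ℂ, f 1 = 0 ∧ D.hit f g ∉ D.corad (n - 1) := by
  by_contra! hcon
  refine hg ((D.mem_corad_iff hn).2 (mem_leftTensors_of_contract_mem fun f => ?_))
  have h0 : (f - f 1 • D.counit) 1 = 0 := by simp [D.counit_one]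
  have h := hcon _ h0
  rw [D.hit_eq h0] at h
  have hε : contract D.counit (D.comulSub g) = 0 := by
    simp [comulSub, contract_counit_comul, D.counit_one]
  have hsub : ∀ t, contract (f - f 1 • D.counit) t = contract f t - f 1 • contract D.counit t := by
    intro t
    simp [contract, LinearMap.lTensor_sub, LinearMap.lTensor_smul]
  rwa [hsub, hε, smul_zero, sub_zero] at h

/-- The degree of a square is twice the degree. -/
lemma mul_self_not_mem_corad (e : ℕ) {g : H} (hg : g ∈ D.corad e) (hg' : g ∉ D.corad (e - 1)) :
    g * g ∉ D.corad (2 * e - 1) := by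
  induction e using Nat.strong_induction_on generalizing g with
  | _ e ih =>
    rcases Nat.eq_zero_or_pos e with rfl | he
    · have := D.nontrivial
      obtain ⟨c, rfl⟩ := D.mem_corad_zero_iff.1 (by simpa using hg)
      rw [D.corad_neg (by simp), Submodule.mem_bot] at hg' ⊢
      simpa using hg'
    classical
    obtain ⟨f, hf, hfg⟩ := D.exists_hit_not_mem (n := e - 1) (by omega) hg'
    have hex : ∃ j : ℕ, (D.hit f ^ (j + 1)) g ∈ D.corad (e - j - 2) := by
      refine ⟨e, ?_⟩
      have := D.hit_pow_mem hf (e + 1) hg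
      rw [D.corad_neg (by push_cast; omega), Submodule.mem_bot] at this
      simp [this]
    obtain ⟨k, hk, hmin⟩ : ∃ k : ℕ, (D.hit f ^ (k + 1)) g ∈ D.corad (e - k - 2) ∧
        ∀ j < k, (D.hit f ^ (j + 1)) g ∉ D.corad (e - j - 2) :=
      ⟨Nat.find hex, Nat.find_spec hex, fun j hj => Nat.find_min hex hj⟩
    match k, hk, hmin with
    | 0, hk, _ =>
      have hle : (e : ℤ) - 2 ≤ e - 1 - 1 := by omega
      exact (hfg (D.corad_mono hle (by simpa using hk))).elim
    | k + 1, hk, hmin =>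
      have hnot := hmin k (Nat.lt_succ_self k)
      have hmem := D.hit_pow_mem hf (k + 1) hg
      have hke : k + 1 ≤ e := by
        by_contra! hlt
        rw [D.corad_neg (by push_cast; omega), Submodule.mem_bot] at hmem
        exact hnot (by simp [hmem])
      intro hsq
      have h1 := D.hit_pow_mem hf (k + 1 + (k + 1)) hsq
      have h2 := D.hit_pow_mul_sub_mem hf _ rfl hg hg hk hk
      refine ih (e - (k + 1)) (by omega) (g := (D.hit f ^ (k + 1)) g)
        (D.corad_mono (by omega) hmem)
        (fun h => hnot (D.corad_mono (by omega) h)) ?_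
      have h3 := sub_mem (D.corad_mono (by push_cast; omega) h1) h2
      rw [sub_sub_cancel, ← Nat.cast_smul_eq_nsmul ℂ] at h3
      have hne : (((k + 1 + (k + 1)).choose (k + 1) : ℕ) : ℂ) ≠ 0 :=
        Nat.cast_ne_zero.2 (Nat.choose_pos (by omega)).ne'
      exact D.corad_mono (by push_cast; omega) ((Submodule.smul_mem_iff _ hne).1 h3)

lemma exists_mem_corad {s : Set H} (hs : Algebra.adjoin ℂ s = ⊤)
    (hprim : ∀ x ∈ s, D.comul x = x ⊗ₜ[ℂ] 1 + 1 ⊗ₜ[ℂ] x) (g : H) :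
    ∃ n : ℕ, g ∈ D.corad n := by
  have hg : g ∈ Algebra.adjoin ℂ s := hs ▸ Algebra.mem_top
  have hone : (1 : H) ∈ D.corad 0 := D.mem_corad_zero_iff.2 ⟨1, by simp⟩
  induction hg using Algebra.adjoin_induction with
  | mem x hx =>
    refine ⟨1, (D.mem_corad_iff (by norm_num)).2 ?_⟩
    have : D.comulSub x = 1 ⊗ₜ[ℂ] x := by simp [comulSub, hprim x hx]
    rw [this]
    exact tmul_mem_leftTensors (by simpa using hone) x
  | algebraMap c => exact ⟨0, D.mem_corad_zero_iff.2 ⟨c, Algebra.algebraMap_eq_smul_one c⟩⟩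
  | add x y _ _ hx hy =>
    obtain ⟨n, hn⟩ := hx
    obtain ⟨m, hm⟩ := hy
    exact ⟨n + m, add_mem (D.corad_mono (by push_cast; omega) hn)
      (D.corad_mono (by push_cast; omega) hm)⟩
  | mul x y _ _ hx hy =>
    obtain ⟨n, hn⟩ := hx
    obtain ⟨m, hm⟩ := hy
    exact ⟨n + m, by simpa using D.mul_mem_corad hn hm⟩

/-- Since every scalar has square roots of all orders, its adjoint has degree zero. -/
lemma star_smul_one_mem_corad_zero (hdeg : ∀ g : H, ∃ n : ℕ, g ∈ D.corad n) (c : ℂ) :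
    star (c • (1 : H)) ∈ D.corad 0 := by
  obtain ⟨n, hn⟩ := hdeg (star (c • (1 : H)))
  induction n using Nat.strong_induction_on generalizing c with
  | _ n ih =>
    rcases Nat.eq_zero_or_pos n with rfl | hpos
    · simpa using hn
    obtain ⟨s, rfl⟩ := IsAlgClosed.exists_eq_mul_self c
    have hsq : star ((s * s) • (1 : H)) = star (s • (1 : H)) * star (s • (1 : H)) := by
      rw [← star_mul, smul_mul_smul_comm, one_mul]
    classical
    have hex := hdeg (star (s • (1 : H)))
    obtain ⟨m, hm, hmin⟩ : ∃ m : ℕ, star (s • (1 : H)) ∈ D.corad m ∧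
        ∀ j < m, star (s • (1 : H)) ∉ D.corad j :=
      ⟨Nat.find hex, Nat.find_spec hex, fun j hj => Nat.find_min hex hj⟩
    have h0 : star (s • (1 : H)) ∈ D.corad 0 := by
      rcases Nat.eq_zero_or_pos m with rfl | hmpos
      · simpa using hm
      refine ih m ?_ s hm
      by_contra! hnm
      refine D.mul_self_not_mem_corad m hm (fun h => hmin (m - 1) (by omega)
        (D.corad_mono (by omega) h)) ?_
      rw [← hsq]
      exact D.corad_mono (by omega) hn
    rw [hsq]
    simpa using D.mul_mem_corad h0 h0

lemma star_smul (hdeg : ∀ g : H, ∃ n : ℕ, g ∈ D.corad n) (c : ℂ) (g : H) :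
    star (c • g) = starRingEnd ℂ c • star g := by
  obtain ⟨d, hd⟩ := D.mem_corad_zero_iff.1 (D.star_smul_one_mem_corad_zero hdeg c)
  have hd' : d = starRingEnd ℂ c := by
    simpa [hd, D.counit_one] using D.counit_star (c • (1 : H))
  rw [← smul_one_mul c g, star_mul, hd, hd', mul_smul_comm, mul_one]

end HopfStarData

lemma IsStarAction.star_smul [Ring A] [Algebra ℂ A] [StarRing A] {D : HopfStarData H}
    {act : H →ₗ[ℂ] A →ₗ[ℂ] A} (hact : IsStarAction D act)
    (hstar : ∀ (c : ℂ) (g : H), star (c • g) = starRingEnd ℂ c • star g) (c : ℂ) (x : A) :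
    star (c • x) = starRingEnd ℂ c • star x := by
  obtain ⟨-, hone, -, -, hs⟩ := hact
  simpa [hone, D.antipode_one, hstar] using hs (c • 1) x

namespace IsUElem

variable [Ring A] [Algebra ℂ A] [StarRing A] {D : HopfStarData H} {act : H →ₗ[ℂ] A →ₗ[ℂ] A}
  {a : H →ₗ[ℂ] A}

lemma map_primitive_mul (hact : IsStarAction D act) (ha : IsUElem D act a) {x : H}
    (hx : D.comul x = x ⊗ₜ[ℂ] 1 + 1 ⊗ₜ[ℂ] x) (h : H) :
    a (x * h) = a x * a h + act x (a h) := by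
  rw [ha.2.1 x h]
  have := D.sum_rep (LinearMap.mul' ℂ A ∘ₗ TensorProduct.map a (act.flip (a h))) x
  simp only [LinearMap.comp_apply, TensorProduct.map_tmul, LinearMap.mul'_apply,
    LinearMap.flip_apply] at this
  rw [this, hx]
  simp [ha.1, hact.2.1]

lemma isCentral_map_primitive (hact : IsStarAction D act) (ha : IsUElem D act a) {x : H}
    (hx : D.comul x = x ⊗ₜ[ℂ] 1 + 1 ⊗ₜ[ℂ] x) : IsCentral (a x) := by
  intro b
  have h := ha.2.2.1 x b
  have h1 := D.sum_rep (LinearMap.mul' ℂ A ∘ₗ TensorProduct.map (act.flip b) a) x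
  have h2 := D.sum_rep (LinearMap.mul' ℂ A ∘ₗ TensorProduct.map a (act.flip b)) x
  simp only [LinearMap.comp_apply, TensorProduct.map_tmul, LinearMap.mul'_apply,
    LinearMap.flip_apply] at h1 h2
  rw [h1, h2, hx] at h
  simp only [map_add, TensorProduct.map_tmul, LinearMap.mul'_apply, LinearMap.flip_apply,
    ha.1, hact.2.1, mul_one, one_mul] at h
  rw [add_comm (a x * b)] at h
  exact (add_left_cancel h).symm

lemma star_map_primitive (ha : IsUElem D act a)
    (hH : ∀ (c : ℂ) (g : H), star (c • g) = starRingEnd ℂ c • star g)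
    (hA : ∀ (c : ℂ) (y : A), star (c • y) = starRingEnd ℂ c • star y) {x : H}
    (hx : D.comul x = x ⊗ₜ[ℂ] 1 + 1 ⊗ₜ[ℂ] x) (hstar : star x = -x)
    (hS : D.antipode x = -x) (hcounit : D.counit x = 0) : star (a x) = -a x := by
  let φ : H →ₗ[ℂ] A :=
    { toFun := fun q => star (a (D.antipode (star q)))
      map_add' := fun p q => by simp
      map_smul' := fun c q => by simp [hH, hA] }
  have h := ha.2.2.2 x
  have h1 := D.sum_rep (LinearMap.mul' ℂ A ∘ₗ TensorProduct.map a φ) x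
  simp only [LinearMap.comp_apply, TensorProduct.map_tmul, LinearMap.mul'_apply] at h1
  change _ = D.counit x • (1 : A) at h
  rw [show ((D.rep x).map fun p => a p.1 * star (a (D.antipode (star p.2)))).sum = _ from h1,
    hx, hcounit] at h
  have hφ1 : φ 1 = 1 := by simp [φ, D.antipode_one, ha.1]
  have hφx : φ x = star (a x) := by simp [φ, hstar, hS]
  simp only [map_add, TensorProduct.map_tmul, LinearMap.mul'_apply, hφ1, hφx, ha.1, mul_one,
    one_mul, zero_smul] at h
  exact eq_neg_of_add_eq_zero_right h

lemma ext_primitive (hact : IsStarAction D act) {b : H →ₗ[ℂ] A} (ha : IsUElem D act a)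
    (hb : IsUElem D act b) {s : Set H} (hs : Algebra.adjoin ℂ s = ⊤)
    (hprim : ∀ x ∈ s, D.comul x = x ⊗ₜ[ℂ] 1 + 1 ⊗ₜ[ℂ] x) (h : ∀ x ∈ s, a x = b x) :
    a = b := by
  have key : ∀ g ∈ Algebra.adjoin ℂ s, ∀ h, a h = b h → a (g * h) = b (g * h) := by
    intro g hg
    induction hg using Algebra.adjoin_induction with
    | mem x hx =>
      intro y hy
      rw [ha.map_primitive_mul hact (hprim x hx), hb.map_primitive_mul hact (hprim x hx), hy,
        h x hx]
    | algebraMap c =>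
      intro y hy
      simp [← Algebra.smul_def, hy]
    | add x y _ _ hx hy =>
      intro z hz
      simp [add_mul, hx z hz, hy z hz]
    | mul x y _ _ hx hy =>
      intro z hz
      rw [mul_assoc]
      exact hx _ (hy z hz)
  ext g
  simpa using key g (hs ▸ Algebra.mem_top) 1 (ha.1.trans hb.1.symm)

end IsUElem

/-- for a `*`-action of `U_ℂ(𝔤)` (a Hopf `*`-algebra `H` generated by
primitive elements `ι ξ`, `ξ ∈ 𝔤`) on `A` and `a ∈ U(U_ℂ(𝔤), A)`, the restriction
`α = a|_𝔤` takes values in the anti-Hermitian central elements, is a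
Chevalley–Eilenberg one-cocycle `α(⁅ξ,η⁆) = ξ ▷ α(η) − η ▷ α(ξ)`, and
`a ↦ a|_𝔤` is an injective group homomorphism into `Z¹_CE(𝔤, Z(A)_{anti-Herm})`. -/
theorem restriction_to_CE_cocycles
    [Ring A] [Algebra ℂ A] [StarRing A]
    (D : HopfStarData H) (act : H →ₗ[ℂ] A →ₗ[ℂ] A) (hact : IsStarAction D act)
    (ι : 𝔤 → H)
    (hadd : ∀ ξ η, ι (ξ + η) = ι ξ + ι η)
    (hsmul : ∀ (r : ℝ) ξ, ι (r • ξ) = (r : ℂ) • ι ξ)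
    (hbr : ∀ ξ η, ι ⁅ξ, η⁆ = ι ξ * ι η - ι η * ι ξ)
    (hprim : ∀ ξ, D.comul (ι ξ) = ι ξ ⊗ₜ[ℂ] 1 + 1 ⊗ₜ[ℂ] ι ξ)
    (hstar : ∀ ξ, star (ι ξ) = - ι ξ)
    (hS : ∀ ξ, D.antipode (ι ξ) = - ι ξ)
    (hcounit : ∀ ξ, D.counit (ι ξ) = 0)
    (hgen : Algebra.adjoin ℂ (Set.range ι) = ⊤) :
    (∀ a, IsUElem D act a →
      (∀ ξ, IsCentral (a (ι ξ)) ∧ star (a (ι ξ)) = - a (ι ξ)) ∧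
      (∀ ξ η, a (ι ⁅ξ, η⁆) = act (ι ξ) (a (ι η)) - act (ι η) (a (ι ξ)))) ∧
    (∀ a b, IsUElem D act a → IsUElem D act b →
      ∀ ξ, conv D a b (ι ξ) = a (ι ξ) + b (ι ξ)) ∧
    (∀ a b, IsUElem D act a → IsUElem D act b →
      (∀ ξ, a (ι ξ) = b (ι ξ)) → a = b) := by
  have hprim' : ∀ x ∈ Set.range ι, D.comul x = x ⊗ₜ[ℂ] 1 + 1 ⊗ₜ[ℂ] x := by
    rintro _ ⟨ξ, rfl⟩
    exact hprim ξ
  have hH := D.star_smul (D.exists_mem_corad hgen hprim')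
  refine ⟨fun a ha => ⟨fun ξ => ⟨ha.isCentral_map_primitive hact (hprim ξ),
    ha.star_map_primitive hH (hact.star_smul hH) (hprim ξ) (hstar ξ) (hS ξ) (hcounit ξ)⟩,
    fun ξ η => ?_⟩, fun a b ha hb ξ => ?_, fun a b ha hb h => ?_⟩
  · rw [hbr, map_sub, ha.map_primitive_mul hact (hprim ξ), ha.map_primitive_mul hact (hprim η),
      ha.isCentral_map_primitive hact (hprim ξ) (a (ι η))]
    abel
  · simp [conv, hprim, ha.1, hb.1]
  · refine ha.ext_primitive hact hb hgen hprim' ?_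
    rintro _ ⟨ξ, rfl⟩
    exact h ξ
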